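/- Let L be a number field of degree d with s pairs of complex embeddings and discriminant Δ_L, and let M_L = |Δ_L|^{1/2}·(4/π)^s·d!/d^d be its Minkowski constant. Let 𝒯 be the set of nonzero prime ideals 𝔮 of O_L with Norm_{L/ℚ}(𝔮) < M_L. Then for any w₁, w₂, w₃ ∈ O_L \ {0} there exists α ∈ L^× such that zᵢ := α·wᵢ ∈ O_L \ {0} for i = 1, 2, 3, and every prime ideal dividing the ideal z₁O_L + z₂O_L + z₃O_L belongs to 𝒯. -/

import Mathlib

open NumberField

/-- The Minkowski constant `M_L = |Δ_L|^{1/2} (4/π)^s d!/d^d` of a number field `L`. -/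
noncomputable def minkowskiConstant (L : Type*) [Field L] [NumberField L] : ℝ :=
  Real.sqrt |(NumberField.discr L : ℝ)| *
    (4 / Real.pi) ^ (NumberField.InfinitePlace.nrComplexPlaces L) *
    (Nat.factorial (Module.finrank ℚ L)) / (Module.finrank ℚ L : ℝ) ^ (Module.finrank ℚ L)

section Aux

open NumberField NumberField.InfinitePlace NumberField.mixedEmbedding Module MeasureTheory Real ENNReal
open scoped nonZeroDivisors NNReal

lemma aux_sum (K : Type*) [Field K] [NumberField K] (I : (FractionalIdeal (𝓞 K)⁰ K)ˣ) :
    ∃ B : ℝ, 0 ≤ B ∧ (B / finrank ℚ K) ^ finrank ℚ K =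
      FractionalIdeal.absNorm I.1 * minkowskiConstant K ∧
    ∃ a ∈ (I : FractionalIdeal (𝓞 K)⁰ K), a ≠ 0 ∧
      ∑ w : InfinitePlace K, (mult w : ℝ) * w a ≤ B := by
  classical
  let B := (minkowskiBound K I * (convexBodySumFactor K)⁻¹).toReal ^ (1 / (finrank ℚ K : ℝ))
  have h_le : (minkowskiBound K I) ≤ volume (convexBodySum K B) := by
    refine le_of_eq ?_
    rw [convexBodySum_volume, ← ENNReal.ofReal_pow (by positivity), ← Real.rpow_natCast,
      ← Real.rpow_mul toReal_nonneg, div_mul_cancel₀, Real.rpow_one, ofReal_toReal, mul_comm,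
      mul_assoc, ← coe_mul, inv_mul_cancel₀ (convexBodySumFactor_ne_zero K), ENNReal.coe_one,
      mul_one]
    · exact mul_ne_top (ne_of_lt (minkowskiBound_lt_top K I)) coe_ne_top
    · exact (Nat.cast_ne_zero.mpr (ne_of_gt finrank_pos))
  refine ⟨B, by positivity, ?_, ?_⟩
  · have e0 : FractionalIdeal.absNorm I.1 * minkowskiConstant K =
      FractionalIdeal.absNorm I.1 * (4 / π) ^ nrComplexPlaces K *
        (finrank ℚ K).factorial * Real.sqrt |discr K| / (finrank ℚ K : ℝ) ^ (finrank ℚ K) := by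
      rw [minkowskiConstant]; ring
    rw [e0, div_pow B, ← Real.rpow_natCast B, ← Real.rpow_mul (by positivity), div_mul_cancel₀ _
      (Nat.cast_ne_zero.mpr <| ne_of_gt finrank_pos), Real.rpow_one]
    congr 1
    calc
      _ = FractionalIdeal.absNorm I.1 * (2 : ℝ)⁻¹ ^ nrComplexPlaces K * NNReal.sqrt ‖discr K‖₊ *
            (2 : ℝ) ^ finrank ℚ K * ((2 : ℝ) ^ nrRealPlaces K * (π / 2) ^ nrComplexPlaces K /
              (Nat.factorial (finrank ℚ K)))⁻¹ := by
        simp_rw [minkowskiBound, convexBodySumFactor,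
          volume_fundamentalDomain_fractionalIdealLatticeBasis,
          volume_fundamentalDomain_latticeBasis, toReal_mul, toReal_pow, toReal_inv, coe_toReal,
          toReal_ofNat, mixedEmbedding.finrank, mul_assoc]
        rw [ENNReal.toReal_ofReal (Rat.cast_nonneg.mpr (FractionalIdeal.absNorm_nonneg I.1))]
        simp_rw [NNReal.coe_inv, NNReal.coe_div, NNReal.coe_mul, NNReal.coe_pow, NNReal.coe_div,
          NNReal.coe_real_pi, NNReal.coe_ofNat, NNReal.coe_natCast]
      _ = FractionalIdeal.absNorm I.1 * (2 : ℝ) ^ (finrank ℚ K - nrComplexPlaces K - nrRealPlaces K +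
            nrComplexPlaces K : ℤ) * Real.sqrt ‖discr K‖ * Nat.factorial (finrank ℚ K) *
              π⁻¹ ^ (nrComplexPlaces K) := by
        simp_rw [inv_div, div_eq_mul_inv, mul_inv, ← zpow_neg_one, ← zpow_natCast, mul_zpow,
          ← zpow_mul, neg_one_mul, mul_neg_one, neg_neg, Real.coe_sqrt, coe_nnnorm, sub_eq_add_neg,
          zpow_add₀ (two_ne_zero : (2 : ℝ) ≠ 0)]
        ring
      _ = FractionalIdeal.absNorm I.1 * (2 : ℝ) ^ (2 * nrComplexPlaces K : ℤ) * Real.sqrt ‖discr K‖ *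
            Nat.factorial (finrank ℚ K) * π⁻¹ ^ (nrComplexPlaces K) := by
        congr
        rw [← card_add_two_mul_card_eq_rank, Nat.cast_add, Nat.cast_mul, Nat.cast_ofNat]
        ring
      _ = FractionalIdeal.absNorm I.1 * (4 / π) ^ nrComplexPlaces K * (finrank ℚ K).factorial *
            Real.sqrt |discr K| := by
        rw [Int.norm_eq_abs, zpow_mul, show (2 : ℝ) ^ (2 : ℤ) = 4 by norm_cast, div_pow,
          inv_eq_one_div, div_pow, one_pow, zpow_natCast]
        ring
  · have h_fund := ZSpan.isAddFundamentalDomain' (fractionalIdealLatticeBasis K I) volume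
    have : Countable (Submodule.span ℤ (Set.range (fractionalIdealLatticeBasis K I))).toAddSubgroup := by
      change Countable (Submodule.span ℤ (Set.range (fractionalIdealLatticeBasis K I)))
      infer_instance
    obtain ⟨⟨x, hx⟩, h_nz, h_mem⟩ := exists_ne_zero_mem_lattice_of_measure_mul_two_pow_le_measure
        h_fund (fun _ ↦ convexBodySum_neg_mem K B) (convexBodySum_convex K B)
        (convexBodySum_compact K B) h_le
    rw [Submodule.mem_toAddSubgroup, mem_span_fractionalIdealLatticeBasis] at hx
    obtain ⟨a, ha, rfl⟩ := hx
    exact ⟨a, ha, by simpa using h_nz, (convexBodySum_mem K B).mp h_mem⟩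

/-- Either a strict inequality, or all absolute values are equal. -/
lemma aux_dich (K : Type*) [Field K] [NumberField K] (I : (FractionalIdeal (𝓞 K)⁰ K)ˣ) :
    ∃ a ∈ (I : FractionalIdeal (𝓞 K)⁰ K), a ≠ 0 ∧
      ((|Algebra.norm ℚ a| : ℚ) : ℝ) ≤ FractionalIdeal.absNorm I.1 * minkowskiConstant K ∧
      (((|Algebra.norm ℚ a| : ℚ) : ℝ) < FractionalIdeal.absNorm I.1 * minkowskiConstant K ∨
      ∀ w w' : InfinitePlace K, w a = w' a) := by
  obtain ⟨B, hB, hBd, a, ha, ha0, hs⟩ := aux_sum K I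
  have hd : (0:ℝ) < finrank ℚ K := Nat.cast_pos.mpr finrank_pos
  refine ⟨a, ha, ha0, ?_⟩
  rw [← hBd]
  set W : InfinitePlace K → ℝ := fun w => (mult w : ℝ) / finrank ℚ K with hW
  have hWpos : ∀ w ∈ Finset.univ, 0 < W w := fun w _ => by
    have : 0 < mult w := mult_pos
    simp only [hW]; positivity
  have hW1 : ∑ w, W w = 1 := by
    rw [hW, ← Finset.sum_div, ← Nat.cast_sum, sum_mult_eq, div_self hd.ne']
  have hz : ∀ w ∈ (Finset.univ : Finset (InfinitePlace K)), 0 ≤ w a := fun w _ => apply_nonneg _ _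
  have hprod : (∏ w : InfinitePlace K, (w a) ^ W w) ^ finrank ℚ K = ((|Algebra.norm ℚ a| : ℚ) : ℝ) := by
    rw [← prod_eq_abs_norm, ← Finset.prod_pow]
    refine Finset.prod_congr rfl fun w _ => ?_
    rw [← Real.rpow_natCast, ← Real.rpow_mul (hz w (Finset.mem_univ w)), hW]
    simp only
    rw [div_mul_cancel₀ _ hd.ne', Real.rpow_natCast]
  have hsum : ∑ w : InfinitePlace K, W w * w a ≤ B / finrank ℚ K := by
    have : ∑ w : InfinitePlace K, W w * w a = (∑ w : InfinitePlace K, (mult w : ℝ) * w a) / finrank ℚ K := by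
      rw [Finset.sum_div]
      exact Finset.sum_congr rfl fun w _ => by simp only [hW]; ring
    rw [this]; gcongr
  have hle := Real.geom_mean_le_arith_mean_weighted Finset.univ W (fun w : InfinitePlace K => w a)
    (fun w hw => (hWpos w hw).le) hW1 hz
  have h0 : 0 ≤ ∏ w : InfinitePlace K, (w a) ^ W w :=
    Finset.prod_nonneg fun w hw => Real.rpow_nonneg (hz w hw) _
  rw [← hprod]
  refine ⟨pow_le_pow_left₀ h0 (hle.trans hsum) _, ?_⟩
  by_cases hall : ∀ w w' : InfinitePlace K, w a = w' a
  · exact Or.inr hall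
  left
  refine pow_lt_pow_left₀ (lt_of_lt_of_le (lt_of_le_of_ne hle fun h => hall ?_) hsum) h0 finrank_pos.ne'
  have := (Real.geom_mean_eq_arith_mean_weighted_iff_of_pos Finset.univ W (fun w : InfinitePlace K => w a) hWpos hW1 hz).1 h
  intro w w'
  exact this w (Finset.mem_univ _) w' (Finset.mem_univ _)

lemma place_eq (K : Type*) [Field K] [NumberField K] (pb : PowerBasis ℚ K) (w w' : InfinitePlace K)
    (x y : ℝ) (hxy : x ≠ y)
    (h1 : ‖w.embedding pb.gen + x‖ = ‖w'.embedding pb.gen + x‖)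
    (h2 : ‖w.embedding pb.gen + y‖ = ‖w'.embedding pb.gen + y‖) : w = w' := by
  have sq : ∀ z : ℂ, ∀ t : ℝ, ‖z + t‖ ^ 2 = (z.re + t) ^ 2 + z.im ^ 2 := by
    intro z t
    rw [Complex.sq_norm, Complex.normSq_apply]; simp; ring
  have e1 := sq (w.embedding pb.gen) x
  have e2 := sq (w.embedding pb.gen) y
  rw [h1, sq] at e1
  rw [h2, sq] at e2
  have hre : (w.embedding pb.gen).re = (w'.embedding pb.gen).re := by
    have : (x - y) * ((w.embedding pb.gen).re - (w'.embedding pb.gen).re) = 0 := by linarith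
    rcases mul_eq_zero.1 this with h | h
    · exact absurd (sub_eq_zero.1 h) hxy
    · linarith
  rw [hre] at e1
  have him : (w'.embedding pb.gen).im ^ 2 = (w.embedding pb.gen).im ^ 2 := by linarith
  have key : ∀ φ ψ : K →+* ℂ, φ pb.gen = ψ pb.gen → φ = ψ := by
    intro φ ψ h
    have : φ.toRatAlgHom = ψ.toRatAlgHom := pb.algHom_ext h
    ext t
    exact DFunLike.congr_fun this t
  rw [← mk_embedding w, ← mk_embedding w', mk_eq_iff]
  rcases sq_eq_sq_iff_eq_or_eq_neg.1 him with h | h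
  · left
    exact key _ _ (Complex.ext hre h.symm)
  · right
    refine key _ _ (Complex.ext ?_ ?_)
    · simp [hre]
    · simp [h]

lemma twisted (K : Type*) [Field K] [NumberField K] (J : (Ideal (𝓞 K))⁰) (b : K) (hb : b ≠ 0) :
    ∃ a : 𝓞 K, a ∈ (J : Ideal (𝓞 K)) ∧ a ≠ 0 ∧
      ((|Algebra.norm ℚ (a : K)| : ℚ) : ℝ) ≤ Ideal.absNorm (J : Ideal (𝓞 K)) * minkowskiConstant K ∧
      (((|Algebra.norm ℚ (a : K)| : ℚ) : ℝ) < Ideal.absNorm (J : Ideal (𝓞 K)) * minkowskiConstant K ∨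
      ∀ w w' : InfinitePlace K, w b * w (a : K) = w' b * w' (a : K)) := by
  obtain ⟨x, hx, hx0, hle, hor⟩ := aux_dich K (toPrincipalIdeal (𝓞 K) K (Units.mk0 b hb) * FractionalIdeal.mk0 K J)
  rw [Units.val_mul, coe_toPrincipalIdeal, FractionalIdeal.coe_mk0] at hx hle hor
  simp only [Units.val_mk0] at hx hle hor
  rw [FractionalIdeal.mem_singleton_mul] at hx
  obtain ⟨y, hy, rfl⟩ := hx
  rw [FractionalIdeal.mem_coeIdeal] at hy
  obtain ⟨a, ha, rfl⟩ := hy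
  have hN : (0:ℝ) < ((|Algebra.norm ℚ b| : ℚ) : ℝ) := by
    have : Algebra.norm ℚ b ≠ 0 := Algebra.norm_ne_zero_iff.2 hb
    exact_mod_cast abs_pos.2 this
  rw [map_mul (FractionalIdeal.absNorm), FractionalIdeal.absNorm_span_singleton,
    FractionalIdeal.coeIdeal_absNorm, map_mul (Algebra.norm ℚ), abs_mul, Rat.cast_mul, Rat.cast_mul, mul_assoc,
    Rat.cast_natCast] at hle hor
  refine ⟨a, ha, ?_, le_of_mul_le_mul_of_pos_left hle hN, ?_⟩
  · rintro rfl; simp at hx0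
  · refine hor.imp (fun h => lt_of_mul_lt_mul_left h hN.le) (fun h w w' => ?_)
    simpa using h w w'

lemma multi (K : Type*) [Field K] [NumberField K] (J : (Ideal (𝓞 K))⁰) (w₁ w₂ : InfinitePlace K)
    (hne : w₁ ≠ w₂) :
    ∃ a : 𝓞 K, a ∈ (J : Ideal (𝓞 K)) ∧ a ≠ 0 ∧
      ((|Algebra.norm ℚ (a : K)| : ℚ) : ℝ) < Ideal.absNorm (J : Ideal (𝓞 K)) * minkowskiConstant K := by
  by_contra hcon
  push Not at hcon
  let pb := Field.powerBasisOfFiniteOfSeparable ℚ K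
  set C : ℝ := Ideal.absNorm (J : Ideal (𝓞 K)) * minkowskiConstant K with hC
  set D : ℝ := max 1 (4 ^ finrank ℚ K * C) with hD
  let S : Set K := {x : K | IsIntegral ℤ x ∧ ∀ φ : K →+* ℂ, ‖φ x‖ ≤ D}
  have hS : S.Finite := NumberField.Embeddings.finite_of_norm_le K ℂ D
  let r : ℕ → ℝ := fun n => w₁ (pb.gen + n) / w₂ (pb.gen + n)
  have hwn : ∀ (w : InfinitePlace K) (n : ℕ), w (n : K) = n := fun w n => by
    rw [← norm_embedding_eq]; simp
  have tri : ∀ (w : InfinitePlace K) (x y : K), w (x + y) ≤ w x + w y := fun w x y => by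
    rw [← norm_embedding_eq, ← norm_embedding_eq, ← norm_embedding_eq, map_add]
    exact norm_add_le _ _
  have hup : ∀ (w : InfinitePlace K) (n : ℕ), w (pb.gen + n) ≤ w pb.gen + n := fun w n => by
    have := tri w pb.gen (n : K)
    rwa [hwn] at this
  have hlo : ∀ (w : InfinitePlace K) (n : ℕ), (n : ℝ) - w pb.gen ≤ w (pb.gen + n) := fun w n => by
    have := tri w (pb.gen + n) (-pb.gen)
    rw [show w (-pb.gen) = w pb.gen by simp [← norm_embedding_eq], add_neg_cancel_comm, hwn] at this
    linarith
  have hev : ∀ᶠ n : ℕ in Filter.atTop, ∀ w : InfinitePlace K, 2 * w pb.gen + 1 ≤ n := by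
    rw [Filter.eventually_all]
    intro w
    exact Filter.tendsto_atTop.1 tendsto_natCast_atTop_atTop _
  have hlim : ∀ w : InfinitePlace K, Filter.Tendsto (fun n : ℕ => w (pb.gen + n) / n) Filter.atTop (nhds 1) := by
    intro w
    have h1 : Filter.Tendsto (fun n : ℕ => 1 + w pb.gen / (n : ℝ)) Filter.atTop (nhds 1) := by
      simpa using (tendsto_const_div_atTop_nhds_zero_nat (w pb.gen)).const_add 1
    have h2 : Filter.Tendsto (fun n : ℕ => 1 - w pb.gen / (n : ℝ)) Filter.atTop (nhds 1) := by
      simpa using (tendsto_const_div_atTop_nhds_zero_nat (w pb.gen)).const_sub 1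
    refine tendsto_of_tendsto_of_tendsto_of_le_of_le' h2 h1 ?_ ?_
    · filter_upwards [Filter.eventually_gt_atTop 0] with n hn
      have hn' : (0:ℝ) < n := Nat.cast_pos.2 hn
      rw [le_div_iff₀ hn', sub_mul, div_mul_cancel₀ _ hn'.ne']
      linarith [hlo w n]
    · filter_upwards [Filter.eventually_gt_atTop 0] with n hn
      have hn' : (0:ℝ) < n := Nat.cast_pos.2 hn
      rw [div_le_iff₀ hn', add_mul, div_mul_cancel₀ _ hn'.ne']
      linarith [hup w n]
  have hr : Filter.Tendsto r Filter.atTop (nhds 1) := by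
    have := (hlim w₁).div (hlim w₂) one_ne_zero
    rw [div_one] at this
    refine this.congr' ?_
    filter_upwards [Filter.eventually_gt_atTop 0] with n hn
    have hn' : (n:ℝ) ≠ 0 := (Nat.cast_pos.2 hn).ne'
    simp only [Pi.div_apply, r]
    rw [div_div_div_cancel_right₀ hn']
  have hmem : ∀ᶠ n : ℕ in Filter.atTop, r n ∈ (fun x : K => w₂ x / w₁ x) '' S := by
    filter_upwards [hev] with n hn
    have hpos : ∀ w : InfinitePlace K, 0 < w (pb.gen + n) := fun w => by
      have := hn w
      have := hlo w n
      have : 0 ≤ w pb.gen := apply_nonneg _ _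
      linarith
    have hb : pb.gen + (n : K) ≠ 0 := fun h => by
      have := hpos w₁; rw [h] at this; simp at this
    obtain ⟨a, haJ, ha0, hle, hor⟩ := twisted K J _ hb
    have heq := hor.resolve_left (not_lt.2 (hcon a haJ ha0))
    have ha0' : (a : K) ≠ 0 := by simpa using ha0
    have hapos : ∀ w : InfinitePlace K, 0 < w (a : K) := fun w => pos_iff.2 ha0'
    have h4 : ∀ w w' : InfinitePlace K, w (a : K) ≤ 4 * w' (a : K) := by
      intro w w'
      have e := heq w w'
      have h1 : w' (pb.gen + n) ≤ 4 * w (pb.gen + n) := by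
        have := hn w; have := hn w'; have := hup w' n; have := hlo w n
        linarith
      refine le_of_mul_le_mul_left ?_ (hpos w)
      rw [e]
      nlinarith [hapos w']
    have hbd : ∀ w : InfinitePlace K, w (a : K) ≤ D := by
      intro w
      have h5 : (w (a : K)) ^ finrank ℚ K ≤ 4 ^ finrank ℚ K * C := by
        calc (w (a : K)) ^ finrank ℚ K = ∏ w' : InfinitePlace K, (w (a : K)) ^ mult w' := by
              rw [Finset.prod_pow_eq_pow_sum, sum_mult_eq]
          _ ≤ ∏ w' : InfinitePlace K, (4 * w' (a : K)) ^ mult w' :=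
              Finset.prod_le_prod (fun _ _ => by have := hapos w; positivity)
                (fun w' _ => pow_le_pow_left₀ (hapos w).le (h4 w w') _)
          _ = 4 ^ finrank ℚ K * ((|Algebra.norm ℚ (a : K)| : ℚ) : ℝ) := by
              simp_rw [mul_pow]
              rw [Finset.prod_mul_distrib, Finset.prod_pow_eq_pow_sum, sum_mult_eq, prod_eq_abs_norm]
          _ ≤ _ := by gcongr
      rcases le_total (w (a : K)) 1 with h | h
      · exact h.trans (le_max_left _ _)
      · exact ((le_self_pow₀ h finrank_pos.ne').trans h5).trans (le_max_right _ _)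
    refine ⟨(a : K), ⟨a.isIntegral_coe, fun φ => ?_⟩, ?_⟩
    · have := hbd (InfinitePlace.mk φ)
      rwa [InfinitePlace.apply] at this
    · simp only [r]
      rw [div_eq_div_iff (hapos w₁).ne' (hpos w₂).ne']
      have := heq w₁ w₂
      linarith
  have hone : ∀ᶠ n : ℕ in Filter.atTop, r n = 1 := by
    have hfin : (((fun x : K => w₂ x / w₁ x) '' S) \ {1}).Finite := (hS.image _).subset Set.sdiff_subset
    have : (((fun x : K => w₂ x / w₁ x) '' S) \ {1})ᶜ ∈ nhds (1:ℝ) :=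
      hfin.isClosed.isOpen_compl.mem_nhds (by simp)
    filter_upwards [hr this, hmem] with n h1 h2
    by_contra h
    exact h1 ⟨h2, h⟩
  have hfinal : ∀ᶠ n : ℕ in Filter.atTop, w₁ (pb.gen + n) = w₂ (pb.gen + n) := by
    filter_upwards [hone] with n h
    exact eq_of_div_eq_one h
  obtain ⟨n, hn⟩ := Filter.eventually_atTop.1 hfinal
  have g : ∀ m ≥ n, ‖w₁.embedding pb.gen + (m : ℝ)‖ = ‖w₂.embedding pb.gen + (m : ℝ)‖ := by
    intro m hm
    have := hn m hm
    rw [← norm_embedding_eq, ← norm_embedding_eq] at this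
    simpa using this
  refine hne (place_eq K pb w₁ w₂ (n : ℝ) ((n + 1 : ℕ) : ℝ) ?_ (g n le_rfl) (g (n + 1) (by omega)))
  push_cast
  linarith

lemma imagquad (K : Type*) [Field K] [NumberField K] (J : (Ideal (𝓞 K))⁰) (w₀ : InfinitePlace K)
    (hw₀ : IsComplex w₀) (huniq : ∀ w : InfinitePlace K, w = w₀) :
    ∃ a : 𝓞 K, a ∈ (J : Ideal (𝓞 K)) ∧ a ≠ 0 ∧
      ((|Algebra.norm ℚ (a : K)| : ℚ) : ℝ) < Ideal.absNorm (J : Ideal (𝓞 K)) * minkowskiConstant K := by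
  classical
  have huniv : (Finset.univ : Finset (InfinitePlace K)) = {w₀} := by
    ext w; simp [huniq w]
  have hnorm : ∀ x : K, ((|Algebra.norm ℚ x| : ℚ) : ℝ) = (w₀ x) ^ 2 := fun x => by
    rw [← prod_eq_abs_norm, huniv, Finset.prod_singleton, mult_isComplex ⟨w₀, hw₀⟩]
  have hd : finrank ℚ K = 2 := by
    rw [← sum_mult_eq, huniv, Finset.sum_singleton, mult_isComplex ⟨w₀, hw₀⟩]
  have hr1 : nrRealPlaces K = 0 := by
    rw [nrRealPlaces, Fintype.card_eq_zero_iff]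
    refine ⟨fun ⟨w, hw⟩ => ?_⟩
    rw [huniq w] at hw
    exact (not_isReal_iff_isComplex.2 hw₀) hw
  have hr2 : nrComplexPlaces K = 1 := by
    have := card_add_two_mul_card_eq_rank K
    omega
  have hM : minkowskiConstant K = 2 / π * √|(discr K : ℝ)| := by
    rw [minkowskiConstant, hr2, hd]
    norm_num [Nat.factorial]
    ring
  have hdisc : 0 < √|(discr K : ℝ)| := by
    have : (discr K : ℝ) ≠ 0 := by exact_mod_cast discr_ne_zero K
    positivity
  have hMpos : 0 < minkowskiConstant K := by rw [hM]; positivity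
  have hex : ∃ n : ℕ, ∃ a : 𝓞 K, a ∈ (J : Ideal (𝓞 K)) ∧ a ≠ 0 ∧ (Algebra.norm ℤ a).natAbs = n := by
    obtain ⟨a, ha, ha0⟩ := Submodule.exists_mem_ne_zero_of_ne_bot (nonZeroDivisors.coe_ne_zero J)
    exact ⟨_, a, ha, ha0, rfl⟩
  obtain ⟨a, haJ, ha0, hna⟩ := Nat.find_spec hex
  have hnat : ∀ x : 𝓞 K, ((Algebra.norm ℤ x).natAbs : ℝ) = (w₀ (x : K)) ^ 2 := fun x => by
    rw [← hnorm, ← Algebra.coe_norm_int, Nat.cast_natAbs]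
    push_cast
    rfl
  have hmin : ∀ y : 𝓞 K, y ∈ (J : Ideal (𝓞 K)) → y ≠ 0 → w₀ (a : K) ≤ w₀ (y : K) := by
    intro y hy hy0
    have := Nat.find_min' hex ⟨y, hy, hy0, rfl⟩
    rw [← hna] at this
    have h : ((Algebra.norm ℤ a).natAbs : ℝ) ≤ ((Algebra.norm ℤ y).natAbs : ℝ) := by exact_mod_cast this
    rw [hnat, hnat] at h
    exact le_of_sq_le_sq h (apply_nonneg _ _)
  have ha0' : (a : K) ≠ 0 := by simpa using ha0
  have hapos : 0 < w₀ (a : K) := pos_iff.2 ha0'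
  refine ⟨a, haJ, ha0, ?_⟩
  by_contra hcon
  rw [not_lt] at hcon
  set I : (FractionalIdeal (𝓞 K)⁰ K)ˣ := toPrincipalIdeal (𝓞 K) K (Units.mk0 (a : K)⁻¹ (inv_ne_zero ha0')) * FractionalIdeal.mk0 K J with hI
  have hIv : (I : FractionalIdeal (𝓞 K)⁰ K) = FractionalIdeal.spanSingleton (𝓞 K)⁰ (a : K)⁻¹ * ((J : Ideal (𝓞 K)) : FractionalIdeal (𝓞 K)⁰ K) := by
    rw [hI, Units.val_mul, coe_toPrincipalIdeal, FractionalIdeal.coe_mk0, Units.val_mk0]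
  have hNI : ((FractionalIdeal.absNorm I.1 : ℚ) : ℝ) * minkowskiConstant K ≤ 1 := by
    rw [hIv, map_mul (FractionalIdeal.absNorm), FractionalIdeal.absNorm_span_singleton,
      FractionalIdeal.coeIdeal_absNorm, Rat.cast_mul, Rat.cast_natCast, hnorm, map_inv₀, inv_pow, ← hnorm, mul_assoc]
    rw [hnorm] at hcon ⊢
    rw [inv_mul_le_iff₀ (by positivity), mul_one]
    exact hcon
  -- no short vectors in `I`
  have hshort : ∀ x ∈ (I : FractionalIdeal (𝓞 K)⁰ K), x ≠ 0 → 1 ≤ w₀ x := by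
    intro x hx hx0
    rw [hIv, FractionalIdeal.mem_singleton_mul] at hx
    obtain ⟨y, hy, rfl⟩ := hx
    rw [FractionalIdeal.mem_coeIdeal] at hy
    obtain ⟨y, hy, rfl⟩ := hy
    have hy0 : y ≠ 0 := by rintro rfl; simp at hx0
    rw [map_mul, map_inv₀, inv_mul_eq_div, one_le_div hapos]
    exact hmin y hy hy0
  have hone : (1 : K) ∈ (I : FractionalIdeal (𝓞 K)⁰ K) := by
    rw [hIv, FractionalIdeal.mem_singleton_mul]
    refine ⟨(a : K), ?_, (inv_mul_cancel₀ ha0').symm⟩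
    rw [FractionalIdeal.mem_coeIdeal]
    exact ⟨a, haJ, rfl⟩
  let f : InfinitePlace K → ℝ≥0 := fun _ => NNReal.sqrt (4 / 5)
  have hvol : minkowskiBound K I < volume (convexBodyLT' K f ⟨w₀, hw₀⟩) := by
    have hv : volume (convexBodyLT' K f ⟨w₀, hw₀⟩) = ENNReal.ofReal (16 / 5) := by
      rw [convexBodyLT'_volume, huniv, Finset.prod_singleton, mult_isComplex ⟨w₀, hw₀⟩, NNReal.sq_sqrt,
        convexBodyLT'Factor, hr1, hr2, ENNReal.ofReal]
      norm_cast
      rw [← NNReal.coe_inj, Real.coe_toNNReal _ (by norm_num)]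
      push_cast
      norm_num
    have hm : (minkowskiBound K I) = ENNReal.ofReal (FractionalIdeal.absNorm I.1 * (2⁻¹ * √|(discr K : ℝ)|) * 4) := by
      rw [← ENNReal.ofReal_toReal (minkowskiBound_lt_top K I).ne]
      congr 1
      rw [minkowskiBound, volume_fundamentalDomain_fractionalIdealLatticeBasis,
        volume_fundamentalDomain_latticeBasis, mixedEmbedding.finrank, hr2, hd]
      simp_rw [toReal_mul, toReal_pow, toReal_inv, coe_toReal, toReal_ofNat]
      rw [ENNReal.toReal_ofReal (Rat.cast_nonneg.mpr (FractionalIdeal.absNorm_nonneg I.1))]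
      rw [Real.coe_sqrt, coe_nnnorm, Int.norm_eq_abs]
      norm_num
    rw [hv, hm]
    refine (ENNReal.ofReal_lt_ofReal_iff (by norm_num)).2 ?_
    have e : FractionalIdeal.absNorm I.1 * (2⁻¹ * √|(discr K : ℝ)|) * 4 =
        π * (FractionalIdeal.absNorm I.1 * minkowskiConstant K) := by
      rw [hM]; field_simp; ring
    rw [e]
    have := Real.pi_lt_d2
    nlinarith [Real.pi_pos]
  obtain ⟨x, hxI, hx0, -, hre, him⟩ := exists_ne_zero_mem_ideal_lt' K I ⟨w₀, hw₀⟩ hvol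
  have hf : ((f w₀ : ℝ≥0) : ℝ) ^ 2 = 4 / 5 := by
    have : (f w₀) ^ 2 = 4 / 5 := NNReal.sq_sqrt _
    rw [← NNReal.coe_pow, this]; norm_num
  simp only at hre him
  rw [hf] at him
  set z := w₀.embedding x with hz
  have hsq : ∀ k : ℤ, (w₀ (x - k)) ^ 2 = (z.re - k) ^ 2 + z.im ^ 2 := by
    intro k
    rw [← norm_embedding_eq, Complex.sq_norm, Complex.normSq_apply, map_sub, map_intCast, ← hz]
    simp; ring
  have hge : ∀ k : ℤ, x - k ≠ 0 → 1 ≤ (z.re - k) ^ 2 + z.im ^ 2 := by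
    intro k hk
    rw [← hsq]
    refine one_le_pow₀ (hshort _ ?_ hk)
    have h1 : ((k : ℤ) : K) ∈ (I : FractionalIdeal (𝓞 K)⁰ K) := by
      have := (I : FractionalIdeal (𝓞 K)⁰ K).val.smul_mem (k : 𝓞 K) hone
      simpa [Algebra.smul_def] using this
    exact (I : FractionalIdeal (𝓞 K)⁰ K).val.sub_mem hxI h1
  by_cases him0 : z.im = 0
  · have := hge 0 (by simpa using hx0)
    rw [him0] at this
    rw [abs_lt] at hre
    push_cast at this
    nlinarith
  · have hk : ∀ k : ℤ, x - k ≠ 0 := by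
      intro k hk
      apply him0
      rw [hz, sub_eq_zero.1 hk]
      simp
    have h0 := hge 0 (hk 0)
    have h1 := hge 1 (hk 1)
    have h2 := hge (-1) (hk (-1))
    rw [abs_lt] at hre him
    have him2 : z.im ^ 2 < 16 / 25 := by nlinarith
    push_cast at h0 h1 h2
    rcases le_total z.re (-1 / 2) with h | h
    · nlinarith
    rcases le_total z.re (1 / 2) with h' | h'
    · nlinarith
    · nlinarith

lemma strict (K : Type*) [Field K] [NumberField K] (J : (Ideal (𝓞 K))⁰) :
    ∃ a : 𝓞 K, a ∈ (J : Ideal (𝓞 K)) ∧ a ≠ 0 ∧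
      (((|Algebra.norm ℚ (a : K)| : ℚ) : ℝ) < Ideal.absNorm (J : Ideal (𝓞 K)) * minkowskiConstant K ∨
      ((|Algebra.norm ℚ (a : K)| : ℚ) : ℝ) ≤ Ideal.absNorm (J : Ideal (𝓞 K))) := by
  by_cases h : ∃ w₁ w₂ : InfinitePlace K, w₁ ≠ w₂
  · obtain ⟨w₁, w₂, h⟩ := h
    obtain ⟨a, h1, h2, h3⟩ := multi K J w₁ w₂ h
    exact ⟨a, h1, h2, Or.inl h3⟩
  push Not at h
  obtain ⟨w₀⟩ : Nonempty (InfinitePlace K) := inferInstance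
  rcases isReal_or_isComplex w₀ with hw | hw
  · have huniv : (Finset.univ : Finset (InfinitePlace K)) = {w₀} := by
      ext w; simp [h w w₀]
    have hd : finrank ℚ K = 1 := by
      rw [← sum_mult_eq, huniv, Finset.sum_singleton, mult_isReal ⟨w₀, hw⟩]
    obtain ⟨a, h1, h2, h3, -⟩ := twisted K J 1 one_ne_zero
    refine ⟨a, h1, h2, Or.inr ?_⟩
    have hM : minkowskiConstant K = 1 := by
      have hr2 : nrComplexPlaces K = 0 := by
        have := card_add_two_mul_card_eq_rank K
        omega
      have hdis : |discr K| = 1 := by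
        obtain ⟨e⟩ : Nonempty (ℚ ≃ₐ[ℚ] K) := by
          have : Function.Bijective (algebraMap ℚ K) := Algebra.finrank_eq_one_iff_bijective_algebraMap.mp hd
          exact ⟨AlgEquiv.ofBijective (Algebra.ofId ℚ K) this⟩
        rw [← discr_eq_discr_of_algEquiv ℚ e, Rat.numberField_discr]; rfl
      have : |(discr K : ℝ)| = 1 := by exact_mod_cast hdis
      rw [minkowskiConstant, this, hr2, hd]; simp
    rwa [hM, mul_one] at h3
  · obtain ⟨a, h1, h2, h3⟩ := imagquad K J w₀ hw (fun w => h w w₀)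
    exact ⟨a, h1, h2, Or.inl h3⟩

lemma main_aux (K : Type*) [Field K] [NumberField K] (J : (Ideal (𝓞 K))⁰) :
    ∃ (I : Ideal (𝓞 K)) (a g : 𝓞 K), I ≠ ⊥ ∧ a ≠ 0 ∧ g ≠ 0 ∧
      Ideal.span {g} * I = Ideal.span {a} * (J : Ideal (𝓞 K)) ∧
      ((Ideal.absNorm I : ℝ) < minkowskiConstant K ∨ I = ⊤) := by
  obtain ⟨J', hJ'⟩ := ClassGroup.mk0_surjective (ClassGroup.mk0 J)⁻¹
  obtain ⟨g, hg, hgJ⟩ := ClassGroup.mk0_eq_mk0_inv_iff.1 hJ'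
  obtain ⟨a, ha, ha0, hor⟩ := strict K J'
  obtain ⟨I, hI⟩ := Ideal.dvd_iff_le.mpr ((Ideal.span_singleton_le_iff_mem _).mpr ha)
  have hI0 : I ≠ ⊥ := by
    rintro rfl
    rw [Ideal.mul_bot, Ideal.span_singleton_eq_bot] at hI
    exact ha0 hI
  have hnorm : ((|Algebra.norm ℚ (a : K)| : ℚ) : ℝ) =
      Ideal.absNorm (J' : Ideal (𝓞 K)) * Ideal.absNorm I := by
    rw [← Nat.cast_mul, ← map_mul, ← hI, Ideal.absNorm_span_singleton, ← Algebra.coe_norm_int, Nat.cast_natAbs]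
    push_cast
    rfl
  have hpos : (0 : ℝ) < Ideal.absNorm (J' : Ideal (𝓞 K)) :=
    Nat.cast_pos.mpr <| Nat.pos_of_ne_zero <| Ideal.absNorm_ne_zero_of_nonZeroDivisors J'
  refine ⟨I, a, g, hI0, ha0, hg, ?_, ?_⟩
  · rw [← hgJ, hI]; ring
  · rw [hnorm] at hor
    refine hor.imp (fun h => lt_of_mul_lt_mul_left h hpos.le) (fun h => ?_)
    have h1 : (Ideal.absNorm I : ℝ) ≤ 1 := by
      refine le_of_mul_le_mul_left ?_ hpos
      rwa [mul_one]
    have h2 : Ideal.absNorm I ≤ 1 := by exact_mod_cast h1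
    have h3 : Ideal.absNorm I ≠ 0 := by rwa [Ne, Ideal.absNorm_eq_zero_iff]
    exact Ideal.absNorm_eq_one_iff.1 (by omega)

end Aux

theorem stmt11 (L : Type*) [Field L] [NumberField L]
    -- `𝒯` is the set of nonzero prime ideals of `O_L` of norm less than `M_L`
    (T : Set (Ideal (𝓞 L)))
    (hT : T = {q : Ideal (𝓞 L) | q ≠ ⊥ ∧ q.IsPrime ∧
      (Ideal.absNorm q : ℝ) < minkowskiConstant L})
    (w₁ w₂ w₃ : 𝓞 L) (hw₁ : w₁ ≠ 0) (hw₂ : w₂ ≠ 0) (hw₃ : w₃ ≠ 0) :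
    ∃ α : L, α ≠ 0 ∧ ∃ z₁ z₂ z₃ : 𝓞 L, z₁ ≠ 0 ∧ z₂ ≠ 0 ∧ z₃ ≠ 0 ∧
      (z₁ : L) = α * (w₁ : L) ∧ (z₂ : L) = α * (w₂ : L) ∧ (z₃ : L) = α * (w₃ : L) ∧
      ∀ q : Ideal (𝓞 L), q.IsPrime →
        Ideal.span {z₁} + Ideal.span {z₂} + Ideal.span {z₃} ≤ q → q ∈ T := by
  subst hT
  have hJ0 : Ideal.span {w₁} + Ideal.span {w₂} + Ideal.span {w₃} ≠ (⊥ : Ideal (𝓞 L)) := by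
    intro h
    have : w₁ ∈ Ideal.span {w₁} + Ideal.span {w₂} + Ideal.span {w₃} :=
      (le_sup_left.trans le_sup_left : Ideal.span {w₁} ≤ (Ideal.span {w₁} ⊔ Ideal.span {w₂}) ⊔ Ideal.span {w₃})
        (Ideal.mem_span_singleton_self w₁)
    rw [h] at this
    exact hw₁ this
  obtain ⟨I, a, g, hI0, ha0, hg0, hIJ, hor⟩ := main_aux L ⟨_, mem_nonZeroDivisors_iff_ne_zero.mpr hJ0⟩
  simp only at hIJ
  have key : ∀ w : 𝓞 L, w ∈ Ideal.span {w₁} + Ideal.span {w₂} + Ideal.span {w₃} →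
      ∃ z : 𝓞 L, g * z = a * w := by
    intro w hw
    have : a * w ∈ Ideal.span {g} * I := by
      rw [hIJ]
      exact Ideal.mul_mem_mul (Ideal.mem_span_singleton_self a) hw
    obtain ⟨z, -, hz⟩ := Ideal.mem_span_singleton_mul.1 this
    exact ⟨z, hz⟩
  obtain ⟨z₁, hz₁⟩ := key w₁ ((le_sup_left.trans le_sup_left :
    Ideal.span {w₁} ≤ (Ideal.span {w₁} ⊔ Ideal.span {w₂}) ⊔ Ideal.span {w₃}) (Ideal.mem_span_singleton_self w₁))
  obtain ⟨z₂, hz₂⟩ := key w₂ ((le_sup_right.trans le_sup_left :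
    Ideal.span {w₂} ≤ (Ideal.span {w₁} ⊔ Ideal.span {w₂}) ⊔ Ideal.span {w₃}) (Ideal.mem_span_singleton_self w₂))
  obtain ⟨z₃, hz₃⟩ := key w₃ ((le_sup_right :
    Ideal.span {w₃} ≤ (Ideal.span {w₁} ⊔ Ideal.span {w₂}) ⊔ Ideal.span {w₃}) (Ideal.mem_span_singleton_self w₃))
  have hIz : I = Ideal.span {z₁} + Ideal.span {z₂} + Ideal.span {z₃} := by
    have hgb : (Ideal.span {g} : Ideal (𝓞 L)) ≠ 0 := by
      rwa [Ne, Ideal.zero_eq_bot, Ideal.span_singleton_eq_bot]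
    apply mul_left_cancel₀ hgb
    rw [hIJ]
    simp only [mul_add, Ideal.span_singleton_mul_span_singleton, hz₁, hz₂, hz₃]
  have hz0 : ∀ w z : 𝓞 L, w ≠ 0 → g * z = a * w → z ≠ 0 := by
    rintro w z hw h rfl
    rw [mul_zero] at h
    exact mul_ne_zero ha0 hw h.symm
  have hgL : (g : L) ≠ 0 := by simpa using hg0
  have haL : (a : L) ≠ 0 := by simpa using ha0
  have hzL : ∀ w z : 𝓞 L, g * z = a * w → (z : L) = (a : L) / (g : L) * (w : L) := by
    intro w z h
    have h' : (g : L) * (z : L) = (a : L) * (w : L) := by exact_mod_cast congrArg (algebraMap (𝓞 L) L) h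
    field_simp
    linear_combination h'
  refine ⟨(a : L) / (g : L), div_ne_zero haL hgL, z₁, z₂, z₃, hz0 _ _ hw₁ hz₁, hz0 _ _ hw₂ hz₂,
    hz0 _ _ hw₃ hz₃, hzL _ _ hz₁, hzL _ _ hz₂, hzL _ _ hz₃, fun q hq hle => ?_⟩
  rw [← hIz] at hle
  have hlt : (Ideal.absNorm I : ℝ) < minkowskiConstant L :=
    hor.resolve_right fun h => hq.ne_top (top_le_iff.1 (h ▸ hle))
  refine ⟨fun h => hI0 (le_bot_iff.1 (h ▸ hle)), hq, lt_of_le_of_lt ?_ hlt⟩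
  have hpos : 0 < Ideal.absNorm I := Nat.pos_of_ne_zero (by rwa [Ne, Ideal.absNorm_eq_zero_iff])
  exact_mod_cast Nat.le_of_dvd hpos (Ideal.absNorm_dvd_absNorm_of_le hle)
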